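/- The intersection B_{α-α²} ∩ B_{1-α} is the singleton { -α² }. -/

import Mathlib

open Complex Filter Topology

noncomputable section

/-- The word `w₁w₂w₃w₄` is lexicographically smaller than the word `(a-1)(a-1)01`. -/
def WordLt (a : ℤ) (w₁ w₂ w₃ w₄ : ℤ) : Prop :=
  w₁ < a - 1 ∨ (w₁ = a - 1 ∧ (w₂ < a - 1 ∨ (w₂ = a - 1 ∧ (w₃ < 0 ∨ (w₃ = 0 ∧ w₄ < 1)))))

/-- A sequence of integers `(c i)_{i ≥ k}` with `0 ≤ c i ≤ a-1` is admissible if for every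
`i ≥ k+3` the word `c i, c (i-1), c (i-2), c (i-3)` is lexicographically smaller
than `(a-1)(a-1)01`. (Values of `c` below index `k` are irrelevant.) -/
def Admissible (a k : ℤ) (c : ℤ → ℤ) : Prop :=
  (∀ i, k ≤ i → 0 ≤ c i ∧ c i ≤ a - 1) ∧
  (∀ i, k + 3 ≤ i → WordLt a (c i) (c (i - 1)) (c (i - 2)) (c (i - 3)))

/-- The Rauzy fractal `R_a = { Σ_{i=2}^∞ c_i α^i : (c_i)_{i≥2} admissible }`. -/
def Rauzy (a : ℤ) (α : ℂ) : Set ℂ :=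
  {z | ∃ c : ℤ → ℤ, Admissible a 2 c ∧
    z = ∑' n : ℕ, (c ((n : ℤ) + 2) : ℂ) * α ^ (n + 2)}

/-- `B_v = R_a ∩ (R_a + v)`. -/
def BSet (a : ℤ) (α : ℂ) (v : ℂ) : Set ℂ :=
  Rauzy a α ∩ ((· + v) '' Rauzy a α)

/-- `B'_{α-1}`: points of `B_{α-1}` admitting an admissible expansion
`z = α - 1 + Σ_{i=3}^∞ c_i α^i` with `c 3 ≠ a-1`. -/
def Bprime (a : ℤ) (α : ℂ) : Set ℂ :=
  {z | z ∈ BSet a α (α - 1) ∧ ∃ c : ℤ → ℤ, Admissible a 3 c ∧ c 3 ≠ a - 1 ∧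
    z = α - 1 + ∑' n : ℕ, (c ((n : ℤ) + 3) : ℂ) * α ^ (n + 3)}

/-- `g_{2k+1}(z) = -1 - k α³ + α³ z`. -/
def gOdd (α : ℂ) (k : ℤ) (z : ℂ) : ℂ := -1 - (k : ℂ) * α ^ 3 + α ^ 3 * z

/-- `g_{2k}(z) = α - 1 + (a-1-k) α³ + α² z`. -/
def gEven (a : ℤ) (α : ℂ) (k : ℤ) (z : ℂ) : ℂ :=
  α - 1 + ((a : ℂ) - 1 - (k : ℂ)) * α ^ 3 + α ^ 2 * z

/-- A bounded sequence of differences of tails, driven by digit differences `k`. -/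
def GoodSeq (a : ℤ) (α : ℂ) (D : ℕ → ℂ) (k : ℕ → ℤ) : Prop :=
  (∃ C : ℝ, ∀ n, ‖D n‖ ≤ C) ∧ (∀ n, |k n| ≤ a - 1) ∧
    ∀ n, α * D (n + 1) = D n + (k n : ℂ) * α ^ 2

theorem root_facts (a : ℤ) (ha : 3 ≤ a) (α : ℂ)
    (hroot : α ^ 3 - (a : ℂ) * α ^ 2 + α - 1 = 0) (hα : α.im ≠ 0) :
    ∃ m : ℝ, 0 < m ∧ m < 37 / 100 ∧ m * ((a : ℝ) - m + m ^ 2) = 1 ∧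
      m = α.re ^ 2 + α.im ^ 2 ∧ 2 * α.re = m * (1 - m) ∧
      α ^ 2 = ((m * (1 - m) : ℝ) : ℂ) * α - (m : ℂ) := by
  obtain ⟨u, v⟩ := α
  simp only at hα
  have h1 := congrArg Complex.re hroot
  have h2 := congrArg Complex.im hroot
  simp [pow_succ] at h1 h2
  have h3 : 3 * u ^ 2 - v ^ 2 - 2 * a * u + 1 = 0 := by
    apply mul_left_cancel₀ hα
    linear_combination h2
  have haR : (3 : ℝ) ≤ a := by exact_mod_cast ha
  have hv : 0 < v ^ 2 := by positivity
  -- relations with t = 2u, m = u^2+v^2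
  have e1 : (2 * u) ^ 2 - (u ^ 2 + v ^ 2) - a * (2 * u) + 1 = 0 := by linear_combination h3
  have e2 : (u ^ 2 + v ^ 2) * (a - 2 * u) = 1 := by
    linear_combination h1 - u * h3
  have hm : 0 < u ^ 2 + v ^ 2 := by positivity
  have e3 : 2 * u = (u ^ 2 + v ^ 2) * (1 - (u ^ 2 + v ^ 2)) := by
    linear_combination (-(2 * u)) * e2 - (u ^ 2 + v ^ 2) * e1
  refine ⟨u ^ 2 + v ^ 2, hm, ?_, ?_, rfl, e3, ?_⟩
  · have e4 : (u ^ 2 + v ^ 2) * (a - (u ^ 2 + v ^ 2) * (1 - (u ^ 2 + v ^ 2))) = 1 := by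
      rw [← e3]; exact e2
    generalize u ^ 2 + v ^ 2 = m at *
    by_contra hcon
    push Not at hcon
    nlinarith [mul_le_mul_of_nonneg_left haR hm.le, mul_nonneg hm.le (sq_nonneg (m - 1 / 2)),
      sq_nonneg (m - 1 / 2)]
  · have e4 : (u ^ 2 + v ^ 2) * (a - (u ^ 2 + v ^ 2) * (1 - (u ^ 2 + v ^ 2))) = 1 := by
      rw [← e3]; exact e2
    linear_combination e4
  · rw [← e3]
    apply Complex.ext
    · simp [pow_succ]; ring
    · simp [pow_succ]; ring

theorem norm_lt (a : ℤ) (ha : 3 ≤ a) (α : ℂ)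
    (hroot : α ^ 3 - (a : ℂ) * α ^ 2 + α - 1 = 0) (hα : α.im ≠ 0) : ‖α‖ < 1 := by
  obtain ⟨m, hm0, hm1, -, hm, -, -⟩ := root_facts a ha α hroot hα
  have h : ‖α‖ ^ 2 = m := by
    rw [← Complex.normSq_eq_norm_sq, Complex.normSq_apply, hm]; ring
  have := norm_nonneg α
  nlinarith

theorem key_bound (a : ℤ) (ha : 3 ≤ a) (α : ℂ)
    (hroot : α ^ 3 - (a : ℂ) * α ^ 2 + α - 1 = 0) (hα : α.im ≠ 0)
    (D : ℕ → ℂ) (k : ℕ → ℤ) (hD : GoodSeq a α D k) (n : ℕ) (x y w : ℤ) (hw : |w| ≤ 1)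
    (h : D n = x + y * α + w * α ^ 2) : |x| ≤ 1 := by
  obtain ⟨m, hm0, hm1, hma, hm, hre, hsq⟩ := root_facts a ha α hroot hα
  obtain ⟨⟨C, hC⟩, hk, hrec⟩ := hD
  set Q : ℕ → ℝ := fun n => (D n).im / α.im with hQ
  set P : ℕ → ℝ := fun n => (D n).re - Q n * α.re with hP
  have hQi : ∀ n, (D n).im = Q n * α.im := fun n => by simp only [hQ]; field_simp
  have hDr : ∀ n, (D n).re = P n + Q n * α.re := fun n => by simp only [hP]; ring
  have sqre := congrArg Complex.re hsq
  have sqim := congrArg Complex.im hsq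
  have s1 : (α ^ 2).re = m * (1 - m) * α.re - m := by
    rw [sqre]; simp
  have s2 : (α ^ 2).im = m * (1 - m) * α.im := by
    rw [sqim]; simp
  have hrel : ∀ n, Q n = -(m * (1 - m)) * k n + P (n + 1) + m * (1 - m) * Q (n + 1) ∧
      P n = m * k n - m * Q (n + 1) := by
    intro n
    have e1 := congrArg Complex.re (hrec n)
    have e2 := congrArg Complex.im (hrec n)
    simp only [Complex.mul_re, Complex.mul_im, Complex.add_re, Complex.add_im, Complex.intCast_re,
      Complex.intCast_im, s1, s2, hQi, hDr] at e1 e2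
    have f1 : Q n = -(m * (1 - m)) * k n + P (n + 1) + m * (1 - m) * Q (n + 1) := by
      apply mul_left_cancel₀ hα
      linear_combination -e2 + Q (n + 1) * α.im * hre
    refine ⟨f1, ?_⟩
    linear_combination -e1 - α.re * f1 + Q (n + 1) * hm + Q (n + 1) * α.re * hre
  have hkR : ∀ n, |(k n : ℝ)| ≤ a - 1 := fun n => by exact_mod_cast hk n
  have haR : (3 : ℝ) ≤ a := by exact_mod_cast ha
  have hbdd : BddAbove (Set.range fun n => |Q n|) := by
    refine ⟨C / |α.im|, ?_⟩
    rintro _ ⟨n, rfl⟩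
    simp only [hQ, abs_div]
    gcongr
    exact (Complex.abs_im_le_norm _).trans (hC n)
  set M := ⨆ n, |Q n| with hM
  have hQM : ∀ n, |Q n| ≤ M := fun n => le_ciSup hbdd n
  have hr2 : ∀ n, Q n = -(m * (1 - m)) * k n + (m - (m * (1 - m)) ^ 2) * (k (n + 1) - Q (n + 2))
      + m ^ 2 * (1 - m) * (k (n + 2) - Q (n + 3)) := by
    intro n
    have g0 := hrel n
    have g1 := hrel (n + 1)
    have g2 := hrel (n + 2)
    linear_combination g0.1 + g1.2 + m * (1 - m) * g1.1 + m * (1 - m) * g2.2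
  have hA : 0 ≤ m * (1 - m) := by nlinarith
  have hB : 0 ≤ m - (m * (1 - m)) ^ 2 := by nlinarith [mul_nonneg hA hm0.le]
  have hE : 0 ≤ m ^ 2 * (1 - m) := by nlinarith [mul_nonneg hA hm0.le]
  have hMle : M ≤ m * (1 - m) * (a - 1) + (m - (m * (1 - m)) ^ 2) * (a - 1 + M)
      + m ^ 2 * (1 - m) * (a - 1 + M) := by
    apply ciSup_le
    intro n
    have b0 := abs_le.1 (hkR n)
    have b1 := abs_le.1 (hkR (n + 1))
    have b2 := abs_le.1 (hkR (n + 2))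
    have b3 := abs_le.1 (hQM (n + 2))
    have b4 := abs_le.1 (hQM (n + 3))
    rw [hr2 n, abs_le]
    constructor
    · have := mul_le_mul_of_nonneg_left b0.2 hA
      have := mul_le_mul_of_nonneg_left (show -(a - 1 + M) ≤ (k (n + 1) - Q (n + 2)) by linarith) hB
      have := mul_le_mul_of_nonneg_left (show -(a - 1 + M) ≤ (k (n + 2) - Q (n + 3)) by linarith) hE
      linarith
    · have := mul_le_mul_of_nonneg_left b0.1 hA
      have := mul_le_mul_of_nonneg_left (show (k (n + 1) - Q (n + 2)) ≤ (a - 1 + M) by linarith) hB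
      have := mul_le_mul_of_nonneg_left (show (k (n + 2) - Q (n + 3)) ≤ (a - 1 + M) by linarith) hE
      linarith
  -- bound on P
  have hPM : |P n| ≤ m * (a - 1 + M) := by
    rw [(hrel n).2, abs_le]
    have b1 := abs_le.1 (hkR n)
    have b3 := abs_le.1 (hQM (n + 1))
    constructor <;> nlinarith
  have hna : m * ((a : ℝ) - 1) = (1 - m) * (1 + m ^ 2) := by linear_combination hma
  have hm3 : 0 < 1 - m ^ 3 := by nlinarith [mul_pos hm0 hm0, mul_pos hm0 (mul_pos hm0 hm0)]
  have hfin : (m * (a - 1 + M)) * (1 - m ^ 3) ≤ (1 + m ^ 2) * (1 + m - m ^ 2) := by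
    have h1m : 0 < 1 - m := by linarith
    have : ((m * (a - 1 + M)) * (1 - m ^ 3)) * (1 - m) ≤
        ((1 + m ^ 2) * (1 + m - m ^ 2)) * (1 - m) := by
      have := mul_le_mul_of_nonneg_left hMle hm0.le
      have e : ((1 + m ^ 2) * (1 + m - m ^ 2)) * (1 - m) =
        m * (a - 1) * (1 + m - m ^ 2) := by rw [hna]; ring
      rw [e]
      nlinarith
    exact le_of_mul_le_mul_right this h1m
  have hfin2 : m * (a - 1 + M) < 2 - m := by
    have : (1 + m ^ 2) * (1 + m - m ^ 2) < (2 - m) * (1 - m ^ 3) := by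
      have : 0 < 1 - 2 * m - 3 * m ^ 3 + 2 * m ^ 4 := by
        have h2 : m ^ 2 < 0.1369 := by nlinarith
        have h3 : m ^ 3 < 0.051 := by nlinarith
        have : 0 < m ^ 4 := by positivity
        linarith
      linarith
    exact lt_of_mul_lt_mul_right (hfin.trans_lt this) hm3.le
  have hPn : P n = x - w * m := by
    have e1 := congrArg Complex.re h
    have e2 := congrArg Complex.im h
    simp only [Complex.mul_re, Complex.mul_im, Complex.add_re, Complex.add_im, Complex.intCast_re,
      Complex.intCast_im, s1, s2, hQi, hDr] at e1 e2
    have f1 : Q n = y + w * (m * (1 - m)) := by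
      apply mul_left_cancel₀ hα
      linear_combination e2
    rw [f1] at e1
    linear_combination e1
  have hlt := abs_lt.1 (hPM.trans_lt hfin2)
  rw [hPn] at hlt
  have hwR : |(w : ℝ)| ≤ 1 := by exact_mod_cast hw
  have hw' := abs_le.1 hwR
  have l1 : (x : ℝ) < 2 := by nlinarith
  have l2 : (-2 : ℝ) < x := by nlinarith
  have l1' : x < 2 := by exact_mod_cast l1
  have l2' : -2 < x := by exact_mod_cast l2
  rw [abs_le]; omega

theorem step (a : ℤ) (α : ℂ) (hroot : α ^ 3 - (a : ℂ) * α ^ 2 + α - 1 = 0)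
    (D : ℕ → ℂ) (k : ℕ → ℤ) (hD : GoodSeq a α D k) (n : ℕ) (x y w : ℤ)
    (h : D n = x + y * α + w * α ^ 2) :
    D (n + 1) = ((x + y : ℤ) : ℂ) + ((w - a * x + k n : ℤ) : ℂ) * α + (x : ℂ) * α ^ 2 := by
  have h0 : α ≠ 0 := by rintro rfl; norm_num at hroot
  apply mul_left_cancel₀ h0
  rw [hD.2.2 n, h]
  push_cast
  linear_combination (-x : ℂ) * hroot

theorem two_step (a : ℤ) (ha : 3 ≤ a) (α : ℂ)
    (hroot : α ^ 3 - (a : ℂ) * α ^ 2 + α - 1 = 0) (hα : α.im ≠ 0)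
    (S T : ℕ → ℂ) (k l : ℕ → ℤ) (hS : GoodSeq a α S k) (hT : GoodSeq a α T l)
    (hU : GoodSeq a α (fun n => T n - S n) (fun n => l n - k n)) (n : ℕ)
    (hSn : S n = α - α ^ 2) (hTn : T n = 1 - α) :
    l n = a - 1 ∧ k (n + 1) = a - 1 ∧ S (n + 2) = -(α - α ^ 2) ∧ T (n + 2) = -(1 - α) := by
  have s0 : S n = ((0 : ℤ) : ℂ) + ((1 : ℤ) : ℂ) * α + ((-1 : ℤ) : ℂ) * α ^ 2 := by
    rw [hSn]; push_cast; ring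
  have t0 : T n = ((1 : ℤ) : ℂ) + ((-1 : ℤ) : ℂ) * α + ((0 : ℤ) : ℂ) * α ^ 2 := by
    rw [hTn]; push_cast; ring
  have u0 : (fun n => T n - S n) n =
      ((1 : ℤ) : ℂ) + ((-2 : ℤ) : ℂ) * α + ((1 : ℤ) : ℂ) * α ^ 2 := by
    simp only [hTn, hSn]; push_cast; ring
  have s1 := step a α hroot S k hS n _ _ _ s0
  have t1 := step a α hroot T l hT n _ _ _ t0
  have u1 := step a α hroot _ _ hU n _ _ _ u0
  have s2 := step a α hroot S k hS _ _ _ _ s1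
  have t2 := step a α hroot T l hT _ _ _ _ t1
  have u2 := step a α hroot _ _ hU _ _ _ _ u1
  have bs := abs_le.1 (key_bound a ha α hroot hα _ _ hS _ _ _ _ (by norm_num) s2)
  have bt := abs_le.1 (key_bound a ha α hroot hα _ _ hT _ _ _ _ (by norm_num) t2)
  have bu := abs_le.1 (key_bound a ha α hroot hα _ _ hU _ _ _ _ (by norm_num) u2)
  have kt := abs_le.1 (hT.2.1 n)
  have ku := abs_le.1 (hU.2.1 n)
  simp only at bu ku
  have hl : l n = a - 1 := by omega
  have hk : k n = 0 := by omega
  have s3 := step a α hroot S k hS _ _ _ _ s2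
  have t3 := step a α hroot T l hT _ _ _ _ t2
  have u3 := step a α hroot _ _ hU _ _ _ _ u2
  simp only [hl, hk] at s2 t2 s3 t3 u3
  have bs := abs_le.1 (key_bound a ha α hroot hα _ _ hS _ _ _ _ (by norm_num) s3)
  have bt := abs_le.1 (key_bound a ha α hroot hα _ _ hT _ _ _ _ (by rw [abs_le]; omega) t3)
  have bu := abs_le.1 (key_bound a ha α hroot hα _ _ hU _ _ _ _ (by rw [abs_le]; omega) u3)
  have ks := abs_le.1 (hS.2.1 (n + 1))
  have ku := abs_le.1 (hU.2.1 (n + 1))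
  simp only at ku
  have hk1 : k (n + 1) = a - 1 := by omega
  have hl1 : l (n + 1) = 0 := by omega
  refine ⟨hl, hk1, ?_, ?_⟩
  · rw [show n + 2 = n + 1 + 1 from rfl, s2, hk1]; push_cast; ring
  · rw [show n + 2 = n + 1 + 1 from rfl, t2, hl1]; push_cast; ring

theorem GoodSeq.neg {a : ℤ} {α : ℂ} {D : ℕ → ℂ} {k : ℕ → ℤ} (h : GoodSeq a α D k) :
    GoodSeq a α (fun n => -D n) (fun n => -k n) := by
  obtain ⟨⟨C, hC⟩, hk, hr⟩ := h
  refine ⟨⟨C, fun n => by simpa using hC n⟩, fun n => by simpa using hk n, fun n => ?_⟩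
  push_cast
  linear_combination -hr n

/-- Tail of an expansion. -/
def tailSum (α : ℂ) (c : ℕ → ℤ) (n : ℕ) : ℂ := ∑' i : ℕ, (c (i + n) : ℂ) * α ^ (i + 2)

theorem summ {a : ℤ} {α : ℂ} (hn : ‖α‖ < 1) {c : ℕ → ℤ} (hc : ∀ n, 0 ≤ c n ∧ c n ≤ a - 1) (n : ℕ) :
    Summable (fun i : ℕ => (c (i + n) : ℂ) * α ^ (i + 2)) ∧
    ‖tailSum α c n‖ ≤ ∑' i : ℕ, ((a : ℝ) - 1) * ‖α‖ ^ (i + 2) := by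
  have hs : Summable (fun i : ℕ => ((a : ℝ) - 1) * ‖α‖ ^ (i + 2)) :=
    ((summable_nat_add_iff 2).2 (summable_geometric_of_lt_one (norm_nonneg _) hn)).mul_left _
  have hle : ∀ i, ‖(c (i + n) : ℂ) * α ^ (i + 2)‖ ≤ ((a : ℝ) - 1) * ‖α‖ ^ (i + 2) := by
    intro i
    rw [norm_mul, norm_pow, Complex.norm_intCast]
    gcongr
    have h1 : |c (i + n)| ≤ a - 1 := by rw [abs_of_nonneg (hc _).1]; exact (hc _).2
    exact_mod_cast h1
  exact ⟨Summable.of_norm_bounded hs hle, tsum_of_norm_bounded hs.hasSum hle⟩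

theorem tail_rec {a : ℤ} {α : ℂ} (hn : ‖α‖ < 1) {c : ℕ → ℤ} (hc : ∀ n, 0 ≤ c n ∧ c n ≤ a - 1)
    (n : ℕ) : tailSum α c n = (c n : ℂ) * α ^ 2 + α * tailSum α c (n + 1) := by
  unfold tailSum
  rw [(summ hn hc n).1.tsum_eq_zero_add, ← tsum_mul_left]
  congr 1
  · simp
  · apply tsum_congr
    intro i
    rw [show i + 1 + n = i + (n + 1) by ring]
    ring

theorem good_sub {a : ℤ} {α : ℂ} (hn : ‖α‖ < 1) {c d : ℕ → ℤ} (hc : ∀ n, 0 ≤ c n ∧ c n ≤ a - 1)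
    (hd : ∀ n, 0 ≤ d n ∧ d n ≤ a - 1) :
    GoodSeq a α (fun n => tailSum α c n - tailSum α d n) (fun n => d n - c n) := by
  refine ⟨⟨_, fun n => (norm_sub_le _ _).trans (add_le_add (summ hn hc n).2 (summ hn hd n).2)⟩,
    fun n => ?_, fun n => ?_⟩
  · have := hc n
    have := hd n
    simp only [abs_le]; omega
  · have e1 := tail_rec hn hc n
    have e2 := tail_rec hn hd n
    push_cast
    linear_combination e2 - e1

theorem forward (a : ℤ) (ha : 3 ≤ a) (α : ℂ)
    (hroot : α ^ 3 - (a : ℂ) * α ^ 2 + α - 1 = 0) (hα : α.im ≠ 0)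
    (c d e : ℕ → ℤ) (hc : ∀ n, 0 ≤ c n ∧ c n ≤ a - 1) (hd : ∀ n, 0 ≤ d n ∧ d n ≤ a - 1)
    (he : ∀ n, 0 ≤ e n ∧ e n ≤ a - 1) (h1 : tailSum α c 0 - tailSum α d 0 = α - α ^ 2)
    (h2 : tailSum α c 0 - tailSum α e 0 = 1 - α) : tailSum α c 0 = -α ^ 2 := by
  have hn := norm_lt a ha α hroot hα
  have hS := good_sub hn hc hd
  have hT := good_sub hn hc he
  have hU : GoodSeq a α (fun n => (tailSum α c n - tailSum α e n) -
      (tailSum α c n - tailSum α d n)) (fun n => (e n - c n) - (d n - c n)) := by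
    convert good_sub hn hd he using 2 <;> ring
  have hU' : GoodSeq a α (fun n => -(tailSum α c n - tailSum α e n) -
      -(tailSum α c n - tailSum α d n)) (fun n => -(e n - c n) - -(d n - c n)) := by
    convert hU.neg using 2 <;> ring
  have main : ∀ j : ℕ, (tailSum α c (4 * j) - tailSum α d (4 * j) = α - α ^ 2 ∧
      tailSum α c (4 * j) - tailSum α e (4 * j) = 1 - α) ∧
      tailSum α c 0 + α ^ 2 = (α ^ 4) ^ j * (tailSum α c (4 * j) + α ^ 2) := by
    intro j
    induction j with
    | zero => exact ⟨⟨h1, h2⟩, by simp⟩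
    | succ j ih =>
      obtain ⟨⟨i1, i2⟩, i3⟩ := ih
      obtain ⟨x1, x2, x3, x4⟩ := two_step a ha α hroot hα _ _ _ _ hS hT hU (4 * j) i1 i2
      obtain ⟨y1, y2, y3, y4⟩ := two_step a ha α hroot hα _ _ _ _ hS.neg hT.neg hU' (4 * j + 2)
        (by simp only [x3]; ring) (by simp only [x4]; ring)
      have p0 := hc (4 * j)
      have p1 := hc (4 * j + 1)
      have p2 := hc (4 * j + 2)
      have p3 := hc (4 * j + 2 + 1)
      have q0 := he (4 * j)
      have q1 := hd (4 * j + 1)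
      have q2 := he (4 * j + 2)
      have q3 := hd (4 * j + 2 + 1)
      have c0 : c (4 * j) = 0 := by omega
      have c1 : c (4 * j + 1) = 0 := by omega
      have c2 : c (4 * j + 2) = a - 1 := by omega
      have c3 : c (4 * j + 3) = a - 1 := by
        rw [show 4 * j + 3 = 4 * j + 2 + 1 by ring]; omega
      have r0 := tail_rec hn hc (4 * j)
      have r1 := tail_rec hn hc (4 * j + 1)
      have r2 := tail_rec hn hc (4 * j + 2)
      have r3 := tail_rec hn hc (4 * j + 3)
      rw [c0] at r0
      rw [c1] at r1
      rw [c2] at r2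
      rw [c3] at r3
      push_cast at r0 r1 r2 r3
      rw [show 4 * (j + 1) = 4 * j + 2 + 2 by ring]
      refine ⟨⟨neg_injective y3, neg_injective y4⟩, ?_⟩
      rw [i3, pow_succ (α ^ 4) j, mul_assoc]
      congr 1
      rw [show 4 * j + 2 + 2 = 4 * j + 3 + 1 by ring]
      linear_combination r0 + α * r1 + α ^ 2 * r2 + α ^ 3 * r3 - α ^ 2 * (1 + α) * hroot
  have hlim : Tendsto (fun j : ℕ => (α ^ 4) ^ j * (tailSum α c (4 * j) + α ^ 2)) atTop (𝓝 0) := by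
    have hz : Tendsto (fun j : ℕ => (α ^ 4) ^ j) atTop (𝓝 0) := by
      apply tendsto_pow_atTop_nhds_zero_of_norm_lt_one
      rw [norm_pow]
      exact pow_lt_one₀ (norm_nonneg _) hn (by norm_num)
    apply hz.zero_mul_isBoundedUnder_le
    refine isBoundedUnder_of ⟨_, fun j => (norm_add_le _ _).trans
      (add_le_add_left (summ hn hc (4 * j)).2 _)⟩
  have hconst : Tendsto (fun j : ℕ => (α ^ 4) ^ j * (tailSum α c (4 * j) + α ^ 2)) atTop
      (𝓝 (tailSum α c 0 + α ^ 2)) := by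
    simp_rw [← (main _).2]
    exact tendsto_const_nhds
  have := tendsto_nhds_unique hconst hlim
  linear_combination this

/-- The periodic digit sequence, with a phase. -/
def perSeq (a : ℤ) (r : ℤ) (i : ℤ) : ℤ := if (i + r) % 4 < 2 then 0 else a - 1

theorem perSeq_adm (a : ℤ) (ha : 3 ≤ a) (r : ℤ) : Admissible a 2 (perSeq a r) := by
  constructor
  · intro i _
    unfold perSeq
    split_ifs <;> omega
  · intro i _
    unfold perSeq WordLt
    split_ifs <;> omega

theorem per_tail {a : ℤ} {α : ℂ} (ha : 3 ≤ a) (hn : ‖α‖ < 1) (r : ℤ) (z : ℂ)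
    (hz : z * (1 - α ^ 4) = α ^ 2 * (perSeq a r 2 + perSeq a r 3 * α + perSeq a r 4 * α ^ 2 +
      perSeq a r 5 * α ^ 3)) : z ∈ Rauzy a α := by
  refine ⟨perSeq a r, perSeq_adm a ha r, ?_⟩
  set c : ℕ → ℤ := fun n => perSeq a r ((n : ℤ) + 2) with hcdef
  have hc : ∀ n, 0 ≤ c n ∧ c n ≤ a - 1 := fun n => (perSeq_adm a ha r).1 _ (by omega)
  change z = tailSum α c 0
  have r0 := tail_rec hn hc 0
  have r1 := tail_rec hn hc 1
  have r2 := tail_rec hn hc 2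
  have r3 := tail_rec hn hc 3
  have h4 : tailSum α c 4 = tailSum α c 0 := by
    unfold tailSum
    apply tsum_congr
    intro i
    have : c (i + 4) = c (i + 0) := by
      simp only [hcdef, perSeq]
      push_cast
      congr 1
      apply propext
      omega
    rw [this]
  norm_num at r0 r1 r2 r3
  rw [h4] at r3
  have c0 : c 0 = perSeq a r 2 := rfl
  have c1 : c 1 = perSeq a r 3 := rfl
  have c2 : c 2 = perSeq a r 4 := rfl
  have c3 : c 3 = perSeq a r 5 := rfl
  rw [c0] at r0
  rw [c1] at r1
  rw [c2] at r2
  rw [c3] at r3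
  have hne : 1 - α ^ 4 ≠ 0 := by
    intro h
    have h1 : α ^ 4 = 1 := by linear_combination -h
    have h2 : ‖α‖ ^ 4 < 1 := pow_lt_one₀ (norm_nonneg _) hn (by norm_num)
    rw [← norm_pow, h1, norm_one] at h2
    exact lt_irrefl _ h2
  apply mul_right_cancel₀ hne
  linear_combination hz - r0 - α * r1 - α ^ 2 * r2 - α ^ 3 * r3

theorem bset_inter_3 (a : ℤ) (ha : 3 ≤ a) (α : ℂ)
    (hroot : α ^ 3 - (a : ℂ) * α ^ 2 + α - 1 = 0) (hα : α.im ≠ 0) :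
    BSet a α (α - α ^ 2) ∩ BSet a α (1 - α) = {-α ^ 2} := by
  have hn := norm_lt a ha α hroot hα
  ext z
  simp only [Set.mem_inter_iff, Set.mem_singleton_iff, BSet, Set.mem_image]
  constructor
  · rintro ⟨⟨⟨c, hc, hzc⟩, _, ⟨d, hd, rfl⟩, hzd⟩, _, _, ⟨e, he, rfl⟩, hze⟩
    have hz : z = tailSum α (fun n => c ((n : ℤ) + 2)) 0 := hzc
    have hd' : (∑' n : ℕ, (d ((n : ℤ) + 2) : ℂ) * α ^ (n + 2)) =
      tailSum α (fun n => d ((n : ℤ) + 2)) 0 := rfl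
    have he' : (∑' n : ℕ, (e ((n : ℤ) + 2) : ℂ) * α ^ (n + 2)) =
      tailSum α (fun n => e ((n : ℤ) + 2)) 0 := rfl
    rw [hd'] at hzd
    rw [he'] at hze
    rw [hz]
    apply forward a ha α hroot hα _ (fun n => d ((n : ℤ) + 2)) (fun n => e ((n : ℤ) + 2))
      (fun n => hc.1 _ (by omega)) (fun n => hd.1 _ (by omega)) (fun n => he.1 _ (by omega))
    · rw [← hz]; linear_combination -hzd
    · rw [← hz]; linear_combination -hze
  · rintro rfl
    have m1 : -α ^ 2 ∈ Rauzy a α := by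
      apply per_tail ha hn 2
      norm_num [perSeq]
      linear_combination (1 + α) * α ^ 2 * hroot
    have m2 : -α ∈ Rauzy a α := by
      apply per_tail ha hn 3
      norm_num [perSeq]
      linear_combination (1 + α) * α * hroot
    have m3 : -α ^ 2 - 1 + α ∈ Rauzy a α := by
      apply per_tail ha hn 1
      norm_num [perSeq]
      linear_combination (1 + α ^ 3) * hroot
    exact ⟨⟨m1, -α, m2, by ring⟩, m1, _, m3, by ring⟩
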